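/- Let X = λ₁T + λ₂N + λ₃B be a vector field along α where λ₁, λ₂, λ₃ are real constants with λ₁ ≠ 0. Then X is Fermi–Walker transported along α if and only if either the torsion τ vanishes identically (α is a planar curve) or λ₂ = λ₃ = 0. -/

import Mathlib

/-- The Galilean scalar product on `ℝ³`: `v₁w₁` if `v₁ ≠ 0` or `w₁ ≠ 0`,
and `v₂w₂ + v₃w₃` if `v₁ = 0` and `w₁ = 0`. -/
noncomputable def gProd (v w : Fin 3 → ℝ) : ℝ :=
  if v 0 ≠ 0 ∨ w 0 ≠ 0 then v 0 * w 0 else v 1 * w 1 + v 2 * w 2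

/-- The admissible curve `α(x) = (x, y(x), z(x))` in Galilean 3-space. -/
noncomputable def curve (y z : ℝ → ℝ) : ℝ → Fin 3 → ℝ :=
  fun x => ![x, y x, z x]

/-- The Fermi–Walker derivative along `α = curve y z`:
`∇̃_T X = X' − ⟨T,X⟩A + ⟨A,X⟩T`, where `T = α'` and `A = T' = α''`. -/
noncomputable def FW (y z : ℝ → ℝ) (X : ℝ → Fin 3 → ℝ) (x : ℝ) : Fin 3 → ℝ :=
  deriv X x
    - gProd (deriv (curve y z) x) (X x) • deriv (deriv (curve y z)) x
    + gProd (deriv (deriv (curve y z)) x) (X x) • deriv (curve y z) x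

/-- The tangent `T = α' = (1, y', z')`. -/
noncomputable def Tvec (y z : ℝ → ℝ) (x : ℝ) : Fin 3 → ℝ :=
  ![1, deriv y x, deriv z x]

/-- The curvature `κ = √(y''² + z''²)`. -/
noncomputable def kappa (y z : ℝ → ℝ) (x : ℝ) : ℝ :=
  Real.sqrt (deriv (deriv y) x ^ 2 + deriv (deriv z) x ^ 2)

/-- The principal normal `N = (1/κ)(0, y'', z'')`. -/
noncomputable def Nvec (y z : ℝ → ℝ) (x : ℝ) : Fin 3 → ℝ :=
  (kappa y z x)⁻¹ • ![0, deriv (deriv y) x, deriv (deriv z) x]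

/-- The binormal `B = (1/κ)(0, −z'', y'')`. -/
noncomputable def Bvec (y z : ℝ → ℝ) (x : ℝ) : Fin 3 → ℝ :=
  (kappa y z x)⁻¹ • ![0, -deriv (deriv z) x, deriv (deriv y) x]

/-- The torsion `τ = det(α', α'', α''') / κ²`. -/
noncomputable def tors (y z : ℝ → ℝ) (x : ℝ) : ℝ :=
  (Matrix.of ![![(1 : ℝ), deriv y x, deriv z x],
    ![0, deriv (deriv y) x, deriv (deriv z) x],
    ![0, deriv (deriv (deriv y)) x, deriv (deriv (deriv z)) x]]).det / kappa y z x ^ 2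

theorem hasDerivAt_kappa {y z : ℝ → ℝ} {x p q : ℝ} (hκ : 0 < kappa y z x)
    (hy : HasDerivAt (deriv (deriv y)) p x) (hz : HasDerivAt (deriv (deriv z)) q x) :
    HasDerivAt (kappa y z)
      ((deriv (deriv y) x * p + deriv (deriv z) x * q) / kappa y z x) x := by
  have h := ((hy.pow 2).add (hz.pow 2)).sqrt (Real.sqrt_pos.1 hκ).ne'
  refine h.congr_deriv ?_
  change _ / (2 * kappa y z x) = _
  have := hκ.ne'
  field_simp
  ring

theorem kappa_sq (y z : ℝ → ℝ) (x : ℝ) :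
    kappa y z x ^ 2 = deriv (deriv y) x ^ 2 + deriv (deriv z) x ^ 2 :=
  Real.sq_sqrt (by positivity)

theorem tors_eq (y z : ℝ → ℝ) (x : ℝ) :
    tors y z x = (deriv (deriv y) x * deriv (deriv (deriv z)) x
      - deriv (deriv z) x * deriv (deriv (deriv y)) x) / kappa y z x ^ 2 := by
  simp [tors, Matrix.det_fin_three]

/-- The Frenet equation: the derivative of `N` is `τB`. -/
theorem hasDerivAt_Nvec {y z : ℝ → ℝ} {x : ℝ} (hκ : 0 < kappa y z x)
    (hy : DifferentiableAt ℝ (deriv (deriv y)) x)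
    (hz : DifferentiableAt ℝ (deriv (deriv z)) x) :
    HasDerivAt (Nvec y z) (tors y z x • Bvec y z x) x := by
  have hk := (hasDerivAt_kappa hκ hy.hasDerivAt hz.hasDerivAt).fun_inv hκ.ne'
  have h0 := hκ.ne'
  have h2 := kappa_sq y z x
  rw [hasDerivAt_pi]
  intro i
  fin_cases i
  · simpa [Nvec, Bvec] using hasDerivAt_const x (0 : ℝ)
  · refine (hk.mul hy.hasDerivAt).congr_deriv ?_
    simp only [Bvec, tors_eq, Pi.smul_apply, smul_eq_mul, Fin.mk_one, Matrix.cons_val_one,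
      Matrix.cons_val_zero]
    field_simp
    rw [h2]
    ring
  · refine (hk.mul hz.hasDerivAt).congr_deriv ?_
    simp only [Bvec, tors_eq, Pi.smul_apply, smul_eq_mul, Fin.reduceFinMk, Matrix.cons_val]
    field_simp
    rw [h2]
    ring

/-- The Frenet equation: the derivative of `B` is `-τN`. -/
theorem hasDerivAt_Bvec {y z : ℝ → ℝ} {x : ℝ} (hκ : 0 < kappa y z x)
    (hy : DifferentiableAt ℝ (deriv (deriv y)) x)
    (hz : DifferentiableAt ℝ (deriv (deriv z)) x) :
    HasDerivAt (Bvec y z) (-tors y z x • Nvec y z x) x := by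
  have h := hasDerivAt_pi.1 (hasDerivAt_Nvec hκ hy hz)
  rw [hasDerivAt_pi]
  intro i
  fin_cases i
  · simpa [Nvec, Bvec] using hasDerivAt_const x (0 : ℝ)
  · convert (h 2).fun_neg using 1
    · ext t
      simp [Nvec, Bvec]
    · simp [Nvec, Bvec]
  · convert h 1 using 1
    · ext t
      simp [Nvec, Bvec]
    · simp [Nvec, Bvec]

theorem deriv_curve {y z : ℝ → ℝ} (hy : Differentiable ℝ y) (hz : Differentiable ℝ z) :
    deriv (curve y z) = Tvec y z := by
  ext1 x
  refine HasDerivAt.deriv (hasDerivAt_pi.2 fun i => ?_)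
  fin_cases i
  · exact hasDerivAt_id x
  · exact (hy x).hasDerivAt
  · exact (hz x).hasDerivAt

theorem hasDerivAt_Tvec {y z : ℝ → ℝ} {x : ℝ} (hy : DifferentiableAt ℝ (deriv y) x)
    (hz : DifferentiableAt ℝ (deriv z) x) :
    HasDerivAt (Tvec y z) ![0, deriv (deriv y) x, deriv (deriv z) x] x := by
  refine hasDerivAt_pi.2 fun i => ?_
  fin_cases i
  · exact hasDerivAt_const x 1
  · exact hy.hasDerivAt
  · exact hz.hasDerivAt

/-- The Fermi–Walker derivative of `aT + bN + cB` with constant `a ≠ 0`, `b`, `c` is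
`τ(bB - cN)`. -/
theorem FW_const_coeffs {y z : ℝ → ℝ} (hy : ContDiff ℝ (⊤ : ℕ∞) y)
    (hz : ContDiff ℝ (⊤ : ℕ∞) z) {x : ℝ} (hκ : 0 < kappa y z x) {a b c : ℝ} (ha : a ≠ 0)
    {X : ℝ → Fin 3 → ℝ}
    (hX : ∀ t, X t = a • Tvec y z t + b • Nvec y z t + c • Bvec y z t) :
    FW y z X x = tors y z x • (b • Bvec y z x - c • Nvec y z x) := by
  have hsmooth {f : ℝ → ℝ} (hf : ContDiff ℝ (⊤ : ℕ∞) f) :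
      Differentiable ℝ f ∧ ContDiff ℝ (⊤ : ℕ∞) (deriv f) :=
    contDiff_infty_iff_deriv.1 hf
  obtain ⟨hy0, hy⟩ := hsmooth hy
  obtain ⟨hz0, hz⟩ := hsmooth hz
  obtain ⟨hy1, hy⟩ := hsmooth hy
  obtain ⟨hz1, hz⟩ := hsmooth hz
  have hy2 := (hsmooth hy).1 x
  have hz2 := (hsmooth hz).1 x
  have hT := hasDerivAt_Tvec (hy1 x) (hz1 x)
  have hX' : HasDerivAt X _ x := (((hT.const_smul a).add
    ((hasDerivAt_Nvec hκ hy2 hz2).const_smul b)).add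
    ((hasDerivAt_Bvec hκ hy2 hz2).const_smul c)).congr_of_eventuallyEq
      (Filter.Eventually.of_forall hX)
  have hX0 : X x 0 = a := by simp [hX, Tvec, Nvec, Bvec]
  rw [FW, hX'.deriv, deriv_curve hy0 hz0, hT.deriv]
  have h1 : gProd (Tvec y z x) (X x) = a := by simp [gProd, hX0, Tvec]
  have h2 : gProd ![0, deriv (deriv y) x, deriv (deriv z) x] (X x) = 0 := by
    simp [gProd, hX0, ha]
  rw [h1, h2]
  module

theorem coeffs_eq_zero {y z : ℝ → ℝ} {x : ℝ} (hκ : 0 < kappa y z x) {b c : ℝ}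
    (h : b • Bvec y z x - c • Nvec y z x = 0) : b = 0 ∧ c = 0 := by
  have h1 := congrFun h 1
  have h2 := congrFun h 2
  simp only [Bvec, Nvec, Pi.sub_apply, Pi.smul_apply, smul_eq_mul, Matrix.cons_val,
    Pi.zero_apply] at h1 h2
  have hk := kappa_sq y z x
  have h0 := hκ.ne'
  field_simp at h1 h2
  have hsum : (b ^ 2 + c ^ 2) * kappa y z x ^ 2 = 0 := by
    rw [hk]
    grind
  have := (mul_eq_zero.1 hsum).resolve_right (pow_ne_zero 2 h0)
  constructor <;> nlinarith [sq_nonneg b, sq_nonneg c]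

/-- A field `X = λ₁T + λ₂N + λ₃B` with constant coefficients and `λ₁ ≠ 0`
is Fermi–Walker transported iff the torsion vanishes identically (planar curve) or
`λ₂ = λ₃ = 0`. -/
theorem fermiWalker_transported_const_coeffs_iff
    (y z : ℝ → ℝ) (hy : ContDiff ℝ (⊤ : ℕ∞) y) (hz : ContDiff ℝ (⊤ : ℕ∞) z)
    (hκ : ∀ x, 0 < kappa y z x)
    (lam₁ lam₂ lam₃ : ℝ) (hlam₁ : lam₁ ≠ 0)
    (X : ℝ → Fin 3 → ℝ)
    (hX : ∀ x, X x = lam₁ • Tvec y z x + lam₂ • Nvec y z x + lam₃ • Bvec y z x) :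
    (∀ x : ℝ, FW y z X x = 0) ↔ ((∀ x : ℝ, tors y z x = 0) ∨ (lam₂ = 0 ∧ lam₃ = 0)) := by
  have hFW x := FW_const_coeffs hy hz (hκ x) hlam₁ hX
  constructor
  · intro h
    by_contra! hne
    obtain ⟨⟨x, hx⟩, hlam⟩ := hne
    have hzero := (smul_eq_zero.1 ((hFW x).symm.trans (h x))).resolve_left hx
    obtain ⟨hb, hc⟩ := coeffs_eq_zero (hκ x) hzero
    exact hlam hb hc
  · rintro (hτ | ⟨rfl, rfl⟩) x
    · rw [hFW, hτ, zero_smul]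
    · simp [hFW]
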